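/- Degree-one left eigenpolynomials of the type-(1) Markov chain: suppose λ ∈ ℝ satisfies λ ≠ α_i for all i and the sum rule Σ_{i=1}^n α_i β_i/(λ − α_i) = −1. Set u_i = α_i(λ−1)/(λ−α_i) and P(x) = 1 − (1/N) Σ_{i=1}^n u_i x_i. Then for every y ∈ X, Σ_{x ∈ X} K_n^{(1)}(x,y) P(x) = λ P(y). -/

import Mathlib

open Finset

/-- The set `X = {x ∈ ℕ^n : |x| ≤ N}`. -/
def XSet (n N : ℕ) : Finset (Fin n → ℕ) :=
  (Fintype.piFinset fun _ : Fin n => Finset.range (N + 1)).filter fun x => ∑ i, x i ≤ N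

/-- Binomial weight `W₁(x; y, α) = C(y,x) α^x (1-α)^{y-x}`. -/
noncomputable def W1 (x y : ℕ) (a : ℝ) : ℝ :=
  (y.choose x : ℝ) * a ^ x * (1 - a) ^ (y - x)

/-- Multinomial weight `W_n(x; M, β)`. -/
noncomputable def Wmult {n : ℕ} (x : Fin n → ℕ) (M : ℕ) (β : Fin n → ℝ) : ℝ :=
  ((M.factorial : ℝ) / (((∏ i, (x i).factorial) * (M - ∑ i, x i).factorial : ℕ) : ℝ)) *
    (1 - ∑ i, β i) ^ (M - ∑ i, x i) * ∏ i, (β i) ^ (x i)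

/-- Type-(1) Markov transition matrix. -/
noncomputable def K1 (n N : ℕ) (α β : Fin n → ℝ) (x y : Fin n → ℕ) : ℝ :=
  ∑ z ∈ Fintype.piFinset fun i => Finset.range (min (x i) (y i) + 1),
    Wmult (fun i => x i - z i) (N - ∑ i, z i) β * ∏ i, W1 (z i) (y i) (α i)

/-- Type-(2) Markov transition matrix. -/
noncomputable def K2 (n N : ℕ) (α β : Fin n → ℝ) (x y : Fin n → ℕ) : ℝ :=
  ∑ z ∈ Fintype.piFinset fun i => Finset.Icc (x i + (∑ j, y j) - N) (min (x i) (y i)),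
    Wmult (fun i => x i - z i) (N - ∑ j, y j) β * ∏ i, W1 (z i) (y i) (α i)

/-- Rahman (Aomoto–Gelfand hypergeometric) polynomial `P_m(x; u)`. -/
noncomputable def RahmanP (n N : ℕ) (u : Matrix (Fin n) (Fin n) ℝ) (m x : Fin n → ℕ) : ℝ :=
  ∑ c ∈ ((Fintype.piFinset fun _ : Fin n =>
        Fintype.piFinset fun _ : Fin n => Finset.range (N + 1)).filter
        fun c => ∑ i, ∑ j, c i j ≤ N),
    ((∏ i, (ascPochhammer ℝ (∑ j, c i j)).eval (-(x i : ℝ))) *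
        (∏ j, (ascPochhammer ℝ (∑ i, c i j)).eval (-(m j : ℝ))) /
        (ascPochhammer ℝ (∑ i, ∑ j, c i j)).eval (-(N : ℝ))) *
    ∏ i, ∏ j, u i j ^ (c i j) / ((c i j).factorial : ℝ)

theorem mem_XSet {n N : ℕ} {x : Fin n → ℕ} : x ∈ XSet n N ↔ ∑ i, x i ≤ N := by
  simp only [XSet, Finset.mem_filter, Fintype.mem_piFinset, Finset.mem_range, and_iff_right_iff_imp]
  intro h i
  have := Finset.single_le_sum (f := x) (fun _ _ => Nat.zero_le _) (Finset.mem_univ i)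
  omega

/-- The multinomial theorem with the coefficients of `Wmult`. -/
theorem sum_XSet_multinomial {n : ℕ} (M : ℕ) (c : ℝ) (b : Fin n → ℝ) :
    ∑ w ∈ XSet n M, ((M.factorial : ℝ) /
        (((∏ i, (w i).factorial) * (M - ∑ i, w i).factorial : ℕ) : ℝ)) *
      c ^ (M - ∑ i, w i) * ∏ i, b i ^ w i = (c + ∑ i, b i) ^ M := by
  have h := Finset.sum_pow_eq_sum_piAntidiag (Finset.univ : Finset (Fin (n + 1)))
    (Fin.cons c b : Fin (n + 1) → ℝ) M
  rw [Fin.sum_univ_succ] at h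
  simp only [Fin.cons_zero, Fin.cons_succ] at h
  rw [h]
  refine Finset.sum_nbij' (fun w => Fin.cons (M - ∑ i, w i) w) Fin.tail ?_ ?_ ?_ ?_ ?_
  · intro w hw
    rw [mem_XSet] at hw
    simp [Fin.sum_univ_succ]
    omega
  · intro k hk
    simp only [Finset.mem_piAntidiag, Fin.sum_univ_succ] at hk
    rw [mem_XSet]
    simp only [Fin.tail]
    omega
  · intro w _
    simp
  · intro k hk
    simp only [Finset.mem_piAntidiag, Fin.sum_univ_succ] at hk
    have h0 : M - ∑ i, Fin.tail k i = k 0 := by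
      simp only [Fin.tail]
      omega
    rw [h0, Fin.cons_self_tail]
  · intro w hw
    rw [mem_XSet] at hw
    have hs := Nat.multinomial_spec (Finset.univ : Finset (Fin (n + 1)))
      (Fin.cons (M - ∑ i, w i) w : Fin (n + 1) → ℕ)
    simp only [Fin.prod_univ_succ, Fin.sum_univ_succ, Fin.cons_zero, Fin.cons_succ,
      Nat.sub_add_cancel hw] at hs ⊢
    rw [← hs, mul_comm (Nat.factorial _), Nat.cast_mul, mul_div_cancel_left₀, mul_assoc]
    exact_mod_cast (Nat.mul_pos (Finset.prod_pos fun i _ => Nat.factorial_pos _)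
      (Nat.factorial_pos _)).ne'

theorem prod_mul_ite_pow {n : ℕ} (b : Fin n → ℝ) (w : Fin n → ℕ) (i : Fin n) (t : ℝ) :
    ∏ j, (b j * if j = i then t else 1) ^ w j = (∏ j, b j ^ w j) * t ^ w i := by
  simp_rw [mul_pow, Finset.prod_mul_distrib, ite_pow, one_pow]
  simp

theorem sum_mul_ite {n : ℕ} (b : Fin n → ℝ) (i : Fin n) (t : ℝ) :
    ∑ j, (b j * if j = i then t else 1) = ∑ j, b j + b i * (t - 1) := by
  have h : ∀ j, (b j * if j = i then t else 1) = b j + if j = i then b j * (t - 1) else 0 := by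
    intro j
    split_ifs <;> ring
  simp [h, Finset.sum_add_distrib]

theorem sum_Wmult_mul_pow {n : ℕ} (M : ℕ) (β : Fin n → ℝ) (i : Fin n) (t : ℝ) :
    ∑ w ∈ XSet n M, Wmult w M β * t ^ w i = (1 + β i * (t - 1)) ^ M := by
  have h := sum_XSet_multinomial M (1 - ∑ j, β j) (fun j => β j * if j = i then t else 1)
  rw [sum_mul_ite, show 1 - ∑ j, β j + (∑ j, β j + β i * (t - 1)) = 1 + β i * (t - 1) by ring] at h
  rw [← h]
  refine Finset.sum_congr rfl fun w _ => ?_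
  rw [prod_mul_ite_pow, Wmult]
  ring

/-- A finite generating function determines the first moment. -/
theorem sum_mul_natCast_of_sum_mul_pow {ι : Type*} (s : Finset ι) (f : ι → ℝ) (k : ι → ℕ)
    (p : ℝ) (m : ℕ) (h : ∀ t : ℝ, ∑ x ∈ s, f x * t ^ k x = (1 + p * (t - 1)) ^ m) :
    ∑ x ∈ s, f x * k x = m * p := by
  have hl : HasDerivAt (fun t : ℝ => ∑ x ∈ s, f x * t ^ k x) (∑ x ∈ s, f x * k x) 1 := by
    refine HasDerivAt.fun_sum fun x _ => ?_
    simpa using (hasDerivAt_pow (k x) (1 : ℝ)).const_mul (f x)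
  have hr : HasDerivAt (fun t : ℝ => (1 + p * (t - 1)) ^ m) (m * p) 1 := by
    simpa using ((((hasDerivAt_id (1 : ℝ)).sub_const 1).const_mul p).const_add 1).fun_pow m
  rw [← funext h] at hr
  exact hl.unique hr

theorem sum_Wmult {n : ℕ} (M : ℕ) (β : Fin n → ℝ) : ∑ w ∈ XSet n M, Wmult w M β = 1 := by
  have h := sum_XSet_multinomial M (1 - ∑ j, β j) β
  rw [sub_add_cancel, one_pow] at h
  exact h

theorem sum_Wmult_mul {n : ℕ} (M : ℕ) (β : Fin n → ℝ) (i : Fin n) :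
    ∑ w ∈ XSet n M, Wmult w M β * w i = M * β i :=
  sum_mul_natCast_of_sum_mul_pow _ _ (fun w : Fin n → ℕ => w i) _ _ fun t => sum_Wmult_mul_pow M β i t

theorem sum_W1_mul_pow (y : ℕ) (a t : ℝ) :
    ∑ z ∈ Finset.range (y + 1), W1 z y a * t ^ z = (1 + a * (t - 1)) ^ y := by
  rw [show 1 + a * (t - 1) = a * t + (1 - a) by ring, add_pow]
  refine Finset.sum_congr rfl fun z _ => ?_
  rw [W1, mul_pow]
  ring

theorem sum_W1 (y : ℕ) (a : ℝ) : ∑ z ∈ Finset.range (y + 1), W1 z y a = 1 := by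
  simpa using sum_W1_mul_pow y a 1

theorem sum_prod_W1 {n : ℕ} (α : Fin n → ℝ) (y : Fin n → ℕ) :
    ∑ z ∈ Fintype.piFinset fun i => Finset.range (y i + 1), ∏ i, W1 (z i) (y i) (α i) = 1 := by
  rw [← Finset.prod_univ_sum (fun i => Finset.range (y i + 1)) fun i z => W1 z (y i) (α i)]
  simp [sum_W1]

theorem sum_prod_W1_mul {n : ℕ} (α : Fin n → ℝ) (y : Fin n → ℕ) (i : Fin n) :
    ∑ z ∈ Fintype.piFinset fun i => Finset.range (y i + 1),
      (∏ j, W1 (z j) (y j) (α j)) * z i = y i * α i := by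
  refine sum_mul_natCast_of_sum_mul_pow _ _ (fun z : Fin n → ℕ => z i) _ _ fun t => ?_
  have h := Finset.prod_univ_sum (fun i => Finset.range (y i + 1))
    fun j z => W1 z (y j) (α j) * (if j = i then t else 1) ^ z
  have hf : ∀ j, ∑ z ∈ Finset.range (y j + 1), W1 z (y j) (α j) * (if j = i then t else 1) ^ z
      = if j = i then (1 + α j * (t - 1)) ^ y j else 1 := by
    intro j
    rw [sum_W1_mul_pow]
    split_ifs <;> simp
  simp only [hf, Finset.prod_ite_eq', Finset.mem_univ, if_true] at h
  rw [h]
  refine Finset.sum_congr rfl fun z _ => ?_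
  simp_rw [Finset.prod_mul_distrib, ite_pow, one_pow]
  simp

/-- Summing against the type-(1) kernel: first thin `y` to `z`, then add `w`. -/
theorem sum_K1_mul {n N : ℕ} (α β : Fin n → ℝ) {y : Fin n → ℕ} (hy : y ∈ XSet n N)
    (g : (Fin n → ℕ) → ℝ) :
    ∑ x ∈ XSet n N, K1 n N α β x y * g x =
      ∑ z ∈ Fintype.piFinset fun i => Finset.range (y i + 1),
        (∏ i, W1 (z i) (y i) (α i)) *
          ∑ w ∈ XSet n (N - ∑ i, z i), Wmult w (N - ∑ i, z i) β * g (z + w) := by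
  simp only [K1, Finset.sum_mul, Finset.mul_sum]
  rw [Finset.sum_sigma', Finset.sum_sigma']
  rw [mem_XSet] at hy
  refine Finset.sum_nbij' (fun p => ⟨p.2, p.1 - p.2⟩) (fun p => ⟨p.1 + p.2, p.1⟩) ?_ ?_ ?_ ?_ ?_
  · rintro ⟨x, z⟩ h
    simp only [Finset.mem_sigma, mem_XSet, Fintype.mem_piFinset, Finset.mem_range] at h ⊢
    obtain ⟨hx, hz⟩ := h
    have hs : ∑ i, (x - z) i + ∑ i, z i = ∑ i, x i := by
      rw [← Finset.sum_add_distrib]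
      refine Finset.sum_congr rfl fun i _ => ?_
      have := hz i
      simp only [Pi.sub_apply]
      omega
    refine ⟨fun i => ?_, by omega⟩
    have := hz i
    omega
  · rintro ⟨z, w⟩ h
    simp only [Finset.mem_sigma, mem_XSet, Fintype.mem_piFinset, Finset.mem_range] at h ⊢
    obtain ⟨hz, hw⟩ := h
    have hs : ∑ i, z i ≤ ∑ i, y i := Finset.sum_le_sum fun i _ => Nat.lt_succ_iff.mp (hz i)
    simp only [Pi.add_apply, Finset.sum_add_distrib]
    refine ⟨by omega, fun i => ?_⟩
    have := hz i
    omega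
  · rintro ⟨x, z⟩ h
    simp only [Finset.mem_sigma, Fintype.mem_piFinset, Finset.mem_range] at h
    have hxz : z + (x - z) = x := by
      funext i
      have := h.2 i
      simp only [Pi.add_apply, Pi.sub_apply]
      omega
    simp [hxz]
  · rintro ⟨z, w⟩ _
    simp
  · rintro ⟨x, z⟩ h
    simp only [Finset.mem_sigma, Fintype.mem_piFinset, Finset.mem_range] at h
    have hxz : z + (x - z) = x := by
      funext i
      have := h.2 i
      simp only [Pi.add_apply, Pi.sub_apply]
      omega
    simp only [hxz]
    change Wmult (x - z) _ β * _ * _ = _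
    ring

theorem sum_K1 {n N : ℕ} (α β : Fin n → ℝ) {y : Fin n → ℕ} (hy : y ∈ XSet n N) :
    ∑ x ∈ XSet n N, K1 n N α β x y = 1 := by
  simpa [sum_Wmult, sum_prod_W1] using sum_K1_mul α β hy fun _ => 1

theorem sum_K1_mul_apply {n N : ℕ} (α β : Fin n → ℝ) {y : Fin n → ℕ} (hy : y ∈ XSet n N)
    (i : Fin n) :
    ∑ x ∈ XSet n N, K1 n N α β x y * x i = y i * α i + (N - ∑ j, y j * α j) * β i := by
  rw [sum_K1_mul α β hy fun x => x i]
  rw [mem_XSet] at hy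
  have hz : ∀ z ∈ Fintype.piFinset fun i => Finset.range (y i + 1),
      (∏ i, W1 (z i) (y i) (α i)) * ∑ w ∈ XSet n (N - ∑ i, z i),
          Wmult w (N - ∑ i, z i) β * (((z + w) i : ℕ) : ℝ) =
        (∏ i, W1 (z i) (y i) (α i)) * z i + β i * N * (∏ i, W1 (z i) (y i) (α i))
          - β i * ∑ j, (∏ i, W1 (z i) (y i) (α i)) * z j := by
    intro z hz
    simp only [Fintype.mem_piFinset, Finset.mem_range] at hz
    have hs : ∑ i, z i ≤ ∑ i, y i := Finset.sum_le_sum fun i _ => Nat.lt_succ_iff.mp (hz i)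
    simp only [Pi.add_apply, Nat.cast_add, mul_add, Finset.sum_add_distrib, sum_Wmult_mul,
      ← Finset.sum_mul, sum_Wmult, ← Finset.mul_sum]
    rw [Nat.cast_sub (hs.trans hy), Nat.cast_sum]
    ring
  rw [Finset.sum_congr rfl hz, Finset.sum_sub_distrib, Finset.sum_add_distrib, ← Finset.mul_sum,
    ← Finset.mul_sum, Finset.sum_comm, sum_prod_W1]
  simp only [sum_prod_W1_mul]
  ring

theorem stmt14 (n N : ℕ) (hn : 0 < n) (hN : 0 < N) (α β : Fin n → ℝ)
    (hα : ∀ i, 0 < α i ∧ α i < 1) (hβ : ∀ i, 0 < β i) (hβs : ∑ i, β i < 1)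
    (lam : ℝ) (hne : ∀ i, lam ≠ α i)
    (hsum : ∑ i, α i * β i / (lam - α i) = -1)
    (y : Fin n → ℕ) (hy : y ∈ XSet n N) :
    ∑ x ∈ XSet n N, K1 n N α β x y *
        (1 - (1 / (N : ℝ)) * ∑ i, (α i * (lam - 1) / (lam - α i)) * (x i : ℝ))
      = lam * (1 - (1 / (N : ℝ)) * ∑ i, (α i * (lam - 1) / (lam - α i)) * (y i : ℝ)) := by
  have hN' : (N : ℝ) ≠ 0 := by exact_mod_cast hN.ne'
  set u : Fin n → ℝ := fun i => α i * (lam - 1) / (lam - α i) with hu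
  have huβ : ∑ i, u i * β i = 1 - lam := by
    have h : ∀ i, u i * β i = (lam - 1) * (α i * β i / (lam - α i)) := fun i => by
      simp only [hu]
      ring
    simp only [h, ← Finset.mul_sum, hsum]
    ring
  have huα : ∀ i, u i * α i - (1 - lam) * α i = lam * u i := by
    intro i
    have := sub_ne_zero.mpr (hne i)
    simp only [hu]
    field_simp
    ring
  have hmean : ∑ x ∈ XSet n N, K1 n N α β x y * ∑ i, u i * (x i : ℝ) =
      lam * ∑ i, u i * (y i : ℝ) + N * (1 - lam) := by
    calc ∑ x ∈ XSet n N, K1 n N α β x y * ∑ i, u i * (x i : ℝ)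
        = ∑ i, u i * ∑ x ∈ XSet n N, K1 n N α β x y * x i := by
          simp only [Finset.mul_sum]
          rw [Finset.sum_comm]
          exact Finset.sum_congr rfl fun i _ => Finset.sum_congr rfl fun x _ => by ring
      _ = ∑ i, u i * (y i * α i) + (N - ∑ j, y j * α j) * ∑ i, u i * β i := by
          simp only [sum_K1_mul_apply α β hy, mul_add, Finset.sum_add_distrib]
          rw [Finset.mul_sum]
          congr 1
          exact Finset.sum_congr rfl fun i _ => by ring
      _ = ∑ i, (y i : ℝ) * (u i * α i - (1 - lam) * α i) + N * (1 - lam) := by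
          rw [huβ, sub_mul, Finset.sum_mul, add_sub_left_comm, ← Finset.sum_sub_distrib, add_comm]
          congr 1
          exact Finset.sum_congr rfl fun i _ => by ring
      _ = lam * ∑ i, u i * (y i : ℝ) + N * (1 - lam) := by
          rw [Finset.mul_sum]
          congr 1
          exact Finset.sum_congr rfl fun i _ => by rw [huα]; ring
  have hsplit : ∑ x ∈ XSet n N, K1 n N α β x y * (1 - (1 / (N : ℝ)) * ∑ i, u i * (x i : ℝ)) =
      ∑ x ∈ XSet n N, K1 n N α β x y -
        (1 / (N : ℝ)) * ∑ x ∈ XSet n N, K1 n N α β x y * ∑ i, u i * (x i : ℝ) := by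
    rw [Finset.mul_sum, ← Finset.sum_sub_distrib]
    exact Finset.sum_congr rfl fun x _ => by ring
  change ∑ x ∈ XSet n N, K1 n N α β x y * (1 - (1 / (N : ℝ)) * ∑ i, u i * (x i : ℝ)) =
    lam * (1 - (1 / (N : ℝ)) * ∑ i, u i * (y i : ℝ))
  rw [hsplit, sum_K1 α β hy, hmean]
  field_simp
  ring
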